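/- Let k ≥ 2, x₁,…,x_k ∈ ℤ and y ∈ ℤ. Then Π_{i=1}^k C(x_i,y) ≤ 4^{αk}·Σ_{φ∈S_k} C(x_{φ(k)},y)·Π_{i=1}^{k−1} C(x_{φ(i)},x_{φ(i+1)}). Consequently, Σ_{y∈ℤ} Π_{i=1}^k C(x_i,y) ≤ 4^{αk}·(1+2ζ(α))·Σ_{φ∈S_k} Π_{i=1}^{k−1} C(x_{φ(i)},x_{φ(i+1)}). -/

import Mathlib

open scoped Classical BigOperators

noncomputable section

/-- `C(x,y) = |x-y|^{-α}` for `x ≠ y`, `C(x,x) = 1`. -/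
def Cfun (α : ℝ) (x y : ℤ) : ℝ := if x = y then 1 else |(x : ℝ) - (y : ℝ)| ^ (-α)

/-- `ζ(α) = Σ_{n ≥ 1} n^{-α}`. -/
def zeta (α : ℝ) : ℝ := ∑' n : ℕ, ((n : ℝ) + 1) ^ (-α)

lemma Cfun_nonneg (α : ℝ) (x y : ℤ) : 0 ≤ Cfun α x y := by
  unfold Cfun
  split_ifs
  · exact zero_le_one
  · positivity

lemma Cfun_step (α : ℝ) (hα : 1 < α) (a b y : ℤ) (h : |b - y| ≤ |a - y|) :
    Cfun α a y ≤ (4 : ℝ) ^ α * Cfun α a b := by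
  have h4 : (1 : ℝ) ≤ (4 : ℝ) ^ α := Real.one_le_rpow (by norm_num) (by linarith)
  by_cases hay : a = y
  · subst hay
    have hb : b = a := by
      simp only [sub_self, abs_zero] at h
      have := abs_nonpos_iff.mp h
      omega
    subst hb
    simpa [Cfun] using h4
  · have hpos : (1 : ℝ) ≤ |(a : ℝ) - y| := by
      have : (1 : ℤ) ≤ |a - y| := Int.one_le_abs (by omega)
      exact_mod_cast this
    by_cases hab : a = b
    · have : Cfun α a y ≤ 1 := by
        simp only [Cfun, hay, if_false]
        exact Real.rpow_le_one_of_one_le_of_nonpos hpos (by linarith)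
      have h2 : Cfun α a b = 1 := by simp [Cfun, hab]
      rw [h2]
      linarith
    · have hpos2 : (1 : ℝ) ≤ |(a : ℝ) - b| := by
        have : (1 : ℤ) ≤ |a - b| := Int.one_le_abs (by omega)
        exact_mod_cast this
      have hR : |(b : ℝ) - y| ≤ |(a : ℝ) - y| := by exact_mod_cast h
      have htri : |(a : ℝ) - b| ≤ 4 * |(a : ℝ) - y| := by
        have := abs_sub_le (a : ℝ) y b
        rw [abs_sub_comm (y : ℝ) b] at this
        linarith
      simp only [Cfun, hay, hab, if_false]
      have h1 : (4 * |(a : ℝ) - y|) ^ (-α) ≤ |(a : ℝ) - b| ^ (-α) :=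
        Real.rpow_le_rpow_of_nonpos (by linarith) htri (by linarith)
      rw [Real.mul_rpow (by norm_num) (by linarith), Real.rpow_neg (by norm_num : (0:ℝ) ≤ 4)] at h1
      have h40 : (0 : ℝ) < (4 : ℝ) ^ α := by linarith
      calc |(a : ℝ) - y| ^ (-α)
          = (4 : ℝ) ^ α * (((4 : ℝ) ^ α)⁻¹ * |(a : ℝ) - y| ^ (-α)) := by
            field_simp
        _ ≤ _ := mul_le_mul_of_nonneg_left h1 h40.le

lemma Cfun_hasSum (α : ℝ) (hα : 1 < α) (a : ℤ) :
    HasSum (fun z : ℤ => Cfun α a z) (1 + 2 * zeta α) := by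
  have hs : Summable (fun n : ℕ => ((n : ℝ) + 1) ^ (-α)) := by
    have := (summable_nat_add_iff 1).mpr (Real.summable_nat_rpow.mpr (by linarith : -α < -1))
    simpa using this
  have hz : HasSum (fun n : ℕ => ((n : ℝ) + 1) ^ (-α)) (zeta α) := hs.hasSum
  have h0 : HasSum (fun z : ℤ => Cfun α 0 z) (1 + 2 * zeta α) := by
    have e : 1 + 2 * zeta α = (zeta α + 1) + zeta α := by ring
    rw [e]
    apply HasSum.of_nat_of_neg_add_one
    · have : HasSum (fun n : ℕ => Cfun α 0 ((n + 1 : ℕ) : ℤ)) (zeta α) := by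
        convert hz using 2 with n
        have hn : (0 : ℤ) ≠ ((n + 1 : ℕ) : ℤ) := by omega
        have hp : (0 : ℝ) ≤ (n : ℝ) + 1 := by positivity
        rw [Cfun, if_neg hn]
        congr 1
        push_cast
        rw [zero_sub, abs_neg, abs_of_nonneg hp]
      have h2 := (hasSum_nat_add_iff (f := fun n : ℕ => Cfun α 0 (n : ℤ)) 1).mp this
      simpa [Cfun] using h2
    · convert hz using 2 with n
      have hn : (0 : ℤ) ≠ -((n : ℤ) + 1) := by omega
      have hp : (0 : ℝ) ≤ (n : ℝ) + 1 := by positivity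
      rw [Cfun, if_neg hn]
      congr 1
      push_cast
      rw [zero_sub, neg_neg, abs_of_nonneg hp]
  have h1 := (Equiv.hasSum_iff (Equiv.subRight a)).mpr h0
  convert h1 using 2 with z
  simp only [Function.comp, Equiv.subRight_apply, Cfun]
  have : (a = z) ↔ (0 = z - a) := by omega
  simp only [this]
  congr 2
  push_cast
  rw [show (0 : ℝ) - (z - a) = a - z by ring]

lemma Cfun_pointwise (α : ℝ) (hα : 1 < α) (m : ℕ) (x : Fin (m + 2) → ℤ) (y : ℤ) :
    (∏ i, Cfun α (x i) y) ≤
      (4 : ℝ) ^ (α * (m + 2)) *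
        ∑ φ : Equiv.Perm (Fin (m + 2)),
          Cfun α (x (φ (Fin.last (m + 1)))) y *
          ∏ i : Fin (m + 1), Cfun α (x (φ i.castSucc)) (x (φ i.succ)) := by
  have hT : ∀ φ : Equiv.Perm (Fin (m + 2)), 0 ≤ Cfun α (x (φ (Fin.last (m + 1)))) y *
          ∏ i : Fin (m + 1), Cfun α (x (φ i.castSucc)) (x (φ i.succ)) := fun φ =>
    mul_nonneg (Cfun_nonneg _ _ _) (Finset.prod_nonneg fun _ _ => Cfun_nonneg _ _ _)
  let f : Fin (m + 2) → ℤ := fun i => -|x i - y|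
  let σ : Equiv.Perm (Fin (m + 2)) := Tuple.sort f
  have hmono : Monotone (f ∘ σ) := Tuple.monotone_sort f
  have hstep : ∀ i : Fin (m + 1), Cfun α (x (σ i.castSucc)) y ≤
      (4 : ℝ) ^ α * Cfun α (x (σ i.castSucc)) (x (σ i.succ)) := by
    intro i
    apply Cfun_step α hα
    have := hmono (Fin.castSucc_lt_succ (i := i)).le
    simp only [Function.comp, f] at this
    linarith
  have hpow : ((4 : ℝ) ^ α) ^ (m + 1) ≤ (4 : ℝ) ^ (α * (m + 2)) := by
    rw [← Real.rpow_natCast, ← Real.rpow_mul (by norm_num)]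
    apply Real.rpow_le_rpow_of_exponent_le (by norm_num)
    push_cast
    nlinarith
  calc (∏ i, Cfun α (x i) y) = ∏ i, Cfun α (x (σ i)) y :=
        (Equiv.prod_comp σ (fun i => Cfun α (x i) y)).symm
    _ = (∏ i : Fin (m + 1), Cfun α (x (σ i.castSucc)) y) *
          Cfun α (x (σ (Fin.last (m + 1)))) y := Fin.prod_univ_castSucc _
    _ ≤ (∏ i : Fin (m + 1), (4 : ℝ) ^ α * Cfun α (x (σ i.castSucc)) (x (σ i.succ))) *
          Cfun α (x (σ (Fin.last (m + 1)))) y :=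
        mul_le_mul_of_nonneg_right
          (Finset.prod_le_prod (fun _ _ => Cfun_nonneg _ _ _) (fun i _ => hstep i))
          (Cfun_nonneg _ _ _)
    _ = ((4 : ℝ) ^ α) ^ (m + 1) * (Cfun α (x (σ (Fin.last (m + 1)))) y *
          ∏ i : Fin (m + 1), Cfun α (x (σ i.castSucc)) (x (σ i.succ))) := by
        rw [Finset.prod_mul_distrib, Finset.prod_const, Finset.card_univ, Fintype.card_fin]
        ring
    _ ≤ (4 : ℝ) ^ (α * (m + 2)) * (Cfun α (x (σ (Fin.last (m + 1)))) y *
          ∏ i : Fin (m + 1), Cfun α (x (σ i.castSucc)) (x (σ i.succ))) :=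
        mul_le_mul_of_nonneg_right hpow (hT σ)
    _ ≤ _ := mul_le_mul_of_nonneg_left
        (Finset.single_le_sum (fun φ _ => hT φ) (Finset.mem_univ σ)) (by positivity)

/-- **Lemma.**  For `k ≥ 2` (here `k = m+2`), `x₁,…,x_k, y ∈ ℤ`:
`Π_i C(x_i,y) ≤ 4^{αk} Σ_{φ∈S_k} C(x_{φ(k)},y) Π_{i=1}^{k−1} C(x_{φ(i)},x_{φ(i+1)})`,
and consequently
`Σ_y Π_i C(x_i,y) ≤ 4^{αk} (1+2ζ(α)) Σ_{φ∈S_k} Π_{i=1}^{k−1} C(x_{φ(i)},x_{φ(i+1)})`. -/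
theorem C_chain_bound (α : ℝ) (hα : 1 < α ∧ α ≤ 2) (m : ℕ)
    (x : Fin (m + 2) → ℤ) (y : ℤ) :
    ((∏ i, Cfun α (x i) y) ≤
      (4 : ℝ) ^ (α * (m + 2)) *
        ∑ φ : Equiv.Perm (Fin (m + 2)),
          Cfun α (x (φ (Fin.last (m + 1)))) y *
          ∏ i : Fin (m + 1), Cfun α (x (φ i.castSucc)) (x (φ i.succ))) ∧
    ((∑' z : ℤ, ∏ i, Cfun α (x i) z) ≤
      (4 : ℝ) ^ (α * (m + 2)) * (1 + 2 * zeta α) *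
        ∑ φ : Equiv.Perm (Fin (m + 2)),
          ∏ i : Fin (m + 1), Cfun α (x (φ i.castSucc)) (x (φ i.succ))) := by
  refine ⟨Cfun_pointwise α hα.1 m x y, ?_⟩
  have hS : HasSum (fun z : ℤ => (4 : ℝ) ^ (α * (m + 2)) *
        ∑ φ : Equiv.Perm (Fin (m + 2)),
          Cfun α (x (φ (Fin.last (m + 1)))) z *
          ∏ i : Fin (m + 1), Cfun α (x (φ i.castSucc)) (x (φ i.succ)))
      ((4 : ℝ) ^ (α * (m + 2)) * ∑ φ : Equiv.Perm (Fin (m + 2)), (1 + 2 * zeta α) *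
          ∏ i : Fin (m + 1), Cfun α (x (φ i.castSucc)) (x (φ i.succ))) :=
    (hasSum_sum fun φ _ => (Cfun_hasSum α hα.1 _).mul_right _).mul_left _
  have hL : Summable (fun z : ℤ => ∏ i, Cfun α (x i) z) :=
    Summable.of_nonneg_of_le (fun z => Finset.prod_nonneg fun _ _ => Cfun_nonneg _ _ _)
      (fun z => Cfun_pointwise α hα.1 m x z) hS.summable
  have := hasSum_le (fun z => Cfun_pointwise α hα.1 m x z) hL.hasSum hS
  rwa [← Finset.mul_sum, ← mul_assoc] at this

end
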